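/- Let ω ∈ 𝒲 with associated function τ, let δ ∈ (0, m_τ), and let k be a positive integer. Then any (δ,τ)-lattice {z_j} of 𝔻 can be partitioned into finitely many (M) subsequences such that whenever z_i and z_j are two distinct points of the same subsequence, d_τ(z_i, z_j) ≥ 2^k δ. -/

import Mathlib

open MeasureTheory Filter Set
open scoped ENNReal ComplexOrder

noncomputable section

/-- The open unit disc in `ℂ`. -/
def unitDisc : Set ℂ := Metric.ball (0 : ℂ) 1

/-- Normalized area Lebesgue measure `dA = dx dy / π` on `ℂ`. -/
def dA : Measure ℂ := (ENNReal.ofReal Real.pi)⁻¹ • (volume : Measure ℂ)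

/-- The weighted measure `ω dA` on the unit disc. -/
def muW (ω : ℂ → ℝ) : Measure ℂ :=
  (dA.restrict unitDisc).withDensity fun z => ENNReal.ofReal (ω z)

/-- The radial extension to `𝔻` of a function of `r ∈ [0,1)`. -/
def radialize (τ : ℝ → ℝ) : ℂ → ℝ := fun z => τ (‖z‖)

/-- The class `𝓛`, with constants `c₁, c₂`. -/
structure IsClassL (τC : ℂ → ℝ) (c₁ c₂ : ℝ) : Prop where
  c₁_pos : 0 < c₁
  c₂_pos : 0 < c₂
  pos : ∀ z ∈ unitDisc, 0 < τC z
  upper : ∀ z ∈ unitDisc, τC z ≤ c₁ * (1 - ‖z‖)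
  lip : ∀ z ∈ unitDisc, ∀ ζ ∈ unitDisc, |τC z - τC ζ| ≤ c₂ * ‖z - ζ‖

/-- `m_τ = min(1, c₁⁻¹, c₂⁻¹)/4`. -/
def mTau (c₁ c₂ : ℝ) : ℝ := min 1 (min c₁⁻¹ c₂⁻¹) / 4

/-- The Laplacian `Δφ = φ_xx + φ_yy` of a function `φ : ℂ → ℝ`. -/
def laplacian (φ : ℂ → ℝ) (z : ℂ) : ℝ :=
  fderiv ℝ (fun w => fderiv ℝ φ w 1) z 1 +
    fderiv ℝ (fun w => fderiv ℝ φ w Complex.I) z Complex.I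

/-- The Wirtinger derivative `∂̄g = (g_x + i g_y)/2` of `g : ℂ → ℂ`. -/
def dbar (g : ℂ → ℂ) (z : ℂ) : ℂ :=
  (fderiv ℝ g z 1 + Complex.I * fderiv ℝ g z Complex.I) / 2

/-- The class `𝒲` of weights `ω = e^{-2φ}` with associated radial profile `τ`. -/
structure IsClassW (ω φ : ℂ → ℝ) (τ : ℝ → ℝ) : Prop where
  pos : ∀ z ∈ unitDisc, 0 < ω z
  omega_eq : ∀ z ∈ unitDisc, ω z = Real.exp (-(2 * φ z))
  integrable : ∫⁻ z in unitDisc, ENNReal.ofReal (ω z) ∂dA < ⊤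
  radial : ∀ z ∈ unitDisc, ∀ ζ ∈ unitDisc, ‖z‖ = ‖ζ‖ → φ z = φ ζ
  smooth : ContDiffOn ℝ 2 φ unitDisc
  lap_pos : ∀ z ∈ unitDisc, 0 < laplacian φ z
  tau_pos : ∀ r ∈ Set.Ico (0 : ℝ) 1, 0 < τ r
  tau_anti : AntitoneOn τ (Set.Ico 0 1)
  tau_lim : Tendsto τ (nhdsWithin 1 (Set.Iio 1)) (nhds 0)
  tau_diff : ∀ r ∈ Set.Ico (0 : ℝ) 1, DifferentiableAt ℝ τ r
  tau_deriv_lim : Tendsto (deriv τ) (nhdsWithin 1 (Set.Iio 1)) (nhds 0)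
  comp : ∃ C : ℝ, 1 ≤ C ∧ ∀ z ∈ unitDisc,
    τ (‖z‖) / C ≤ (laplacian φ z) ^ (-(1 / 2 : ℝ)) ∧
      (laplacian φ z) ^ (-(1 / 2 : ℝ)) ≤ C * τ (‖z‖)
  extra : (∃ C > (0 : ℝ), ∃ r₀ ∈ Set.Ico (0 : ℝ) 1,
      MonotoneOn (fun r => τ r * (1 - r) ^ C) (Set.Ico r₀ 1)) ∨
    Tendsto (fun r => deriv τ r * Real.log (1 / τ r)) (nhdsWithin 1 (Set.Iio 1)) (nhds 0)

/-- A `(δ,τ)`-lattice of the unit disc. -/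
structure IsLattice (τC : ℂ → ℝ) (δ : ℝ) (z : ℕ → ℂ) : Prop where
  mem : ∀ j, z j ∈ unitDisc
  sep : ∀ j k, j ≠ k → z j ∉ Metric.ball (z k) (δ * τC (z k))
  covers : ∀ w ∈ unitDisc, ∃ j, w ∈ Metric.ball (z j) (δ * τC (z j))
  mult : ∃ N : ℕ, ∀ w ∈ unitDisc,
    ({j : ℕ | w ∈ Metric.ball (z j) (3 * (δ * τC (z j)))}).ncard ≤ N

/-- The distance `d_τ(z,ζ) = |z-ζ| / min(τ(z),τ(ζ))`. -/
def dTau (τC : ℂ → ℝ) (z ζ : ℂ) : ℝ := ‖z - ζ‖ / min (τC z) (τC ζ)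

/-- `(1/|D(δτ(z))|) ∫_{D(δτ(z))} |u|² dA`, valued in `ℝ≥0∞`. -/
def localMeanE (τC : ℂ → ℝ) (δ : ℝ) (u : ℂ → ℂ) (z : ℂ) : ℝ≥0∞ :=
  (ENNReal.ofReal ((δ * τC z) ^ 2))⁻¹ *
    ∫⁻ w in Metric.ball z (δ * τC z), ENNReal.ofReal (‖u w‖ ^ 2) ∂dA

/-- `F_δ(z)² = inf over h analytic in D(δτ(z)) of the mean square of g - h`. -/
def FdeltaSqE (τC : ℂ → ℝ) (δ : ℝ) (g : ℂ → ℂ) (z : ℂ) : ℝ≥0∞ :=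
  ⨅ (h : ℂ → ℂ) (_ : DifferentiableOn ℂ h (Metric.ball z (δ * τC z))),
    localMeanE τC δ (fun w => g w - h w) z

/-- The submodule of `L²_ω` of elements with a representative analytic on `𝔻`. -/
def bergmanSubmodule (ω : ℂ → ℝ) : Submodule ℂ (Lp ℂ 2 (muW ω)) where
  carrier := {f | ∃ F : ℂ → ℂ, DifferentiableOn ℂ F unitDisc ∧ (f : ℂ → ℂ) =ᵐ[muW ω] F}
  zero_mem' := ⟨0, differentiableOn_const 0, Lp.coeFn_zero ℂ 2 (muW ω)⟩
  add_mem' := by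
    rintro a b ⟨F, hF, ha⟩ ⟨G, hG, hb⟩
    refine ⟨F + G, hF.add hG, ?_⟩
    filter_upwards [Lp.coeFn_add a b, ha, hb] with w h1 h2 h3
    rw [h1]; simp only [Pi.add_apply, h2, h3]
  smul_mem' := by
    rintro c a ⟨F, hF, ha⟩
    refine ⟨c • F, hF.const_smul c, ?_⟩
    filter_upwards [Lp.coeFn_smul c a, ha] with w h1 h2
    rw [h1]; simp only [Pi.smul_apply, h2]

/-- The Bergman space `A²_ω`, a closed subspace of `L²_ω`. -/
def bergmanH (ω : ℂ → ℝ) : Submodule ℂ (Lp ℂ 2 (muW ω)) :=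
  (bergmanSubmodule ω).topologicalClosure

instance (ω : ℂ → ℝ) : CompleteSpace (bergmanH ω) :=
  IsComplete.completeSpace_coe (Submodule.isClosed_topologicalClosure _).isComplete

/-- The orthogonal (Bergman) projection of `L²_ω` onto `A²_ω`, valued in `A²_ω`. -/
def bergmanProjA (ω : ℂ → ℝ) : Lp ℂ 2 (muW ω) →L[ℂ] bergmanH ω :=
  Submodule.orthogonalProjectionOnto (bergmanH ω)

/-- The Bergman projection `P`, viewed as an operator of `L²_ω`. -/
def bergmanProj (ω : ℂ → ℝ) : Lp ℂ 2 (muW ω) →L[ℂ] Lp ℂ 2 (muW ω) :=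
  (bergmanH ω).subtypeL.comp (bergmanProjA ω)

/-- `T` is a bounded extension of the Hankel operator `H_g : f ↦ g f - P(g f)`,
defined on the bounded analytic functions `f ∈ H^∞`. -/
def IsHankelExtension (ω : ℂ → ℝ) (g : ℂ → ℂ)
    (T : bergmanH ω →L[ℂ] Lp ℂ 2 (muW ω)) : Prop :=
  ∀ (f : bergmanH ω) (F : ℂ → ℂ) (M : ℝ),
    DifferentiableOn ℂ F unitDisc →
    (∀ z ∈ unitDisc, ‖F z‖ ≤ M) →
    ((f : Lp ℂ 2 (muW ω)) : ℂ → ℂ) =ᵐ[muW ω] F →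
    ∀ gF : Lp ℂ 2 (muW ω), ((gF : ℂ → ℂ) =ᵐ[muW ω] fun z => g z * F z) →
    T f = gF - bergmanProj ω gF

/-- The `ν`-th singular number `s_ν(T) = inf{‖T - K‖ : rank K ≤ ν}`, `ν = 0, 1, 2, …`. -/
def singularNumber {E F : Type*} [NormedAddCommGroup E] [NormedSpace ℂ E]
    [NormedAddCommGroup F] [NormedSpace ℂ F] (T : E →L[ℂ] F) (ν : ℕ) : ℝ :=
  sInf {c : ℝ | ∃ K : E →L[ℂ] F,
    Module.rank ℂ (LinearMap.range (K : E →ₗ[ℂ] F)) ≤ (ν : Cardinal) ∧ c = ‖T - K‖}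

/-- `‖T‖_{S^p}^p = ∑_ν s_ν(T)^p`. -/
def schattenSum (p : ℝ) {E F : Type*} [NormedAddCommGroup E] [NormedSpace ℂ E]
    [NormedAddCommGroup F] [NormedSpace ℂ F] (T : E →L[ℂ] F) : ℝ :=
  ∑' ν : ℕ, singularNumber T ν ^ p

/-- Membership in the Schatten class `S^p`: `∑_ν s_ν(T)^p < ∞`. -/
def MemSchatten (p : ℝ) {E F : Type*} [NormedAddCommGroup E] [NormedSpace ℂ E]
    [NormedAddCommGroup F] [NormedSpace ℂ F] (T : E →L[ℂ] F) : Prop :=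
  Summable fun ν : ℕ => singularNumber T ν ^ p

/-- A bounded operator has finite rank. -/
def FiniteRank {E F : Type*} [NormedAddCommGroup E] [NormedSpace ℂ E]
    [NormedAddCommGroup F] [NormedSpace ℂ F] (T : E →L[ℂ] F) : Prop :=
  Module.rank ℂ (LinearMap.range (T : E →ₗ[ℂ] F)) < Cardinal.aleph0

/-- The decay estimate `|F(z)| ω(z)^{1/2} ≲ min(1, min(τ(α),τ(z))/|z-α|)^{3n}` on `𝔻`. -/
def TestDecay (τC ω : ℂ → ℝ) (C₀ : ℝ) (n : ℕ) (α : ℂ) (F : ℂ → ℂ) : Prop :=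
  (∀ z ∈ unitDisc, ‖F z‖ * Real.sqrt (ω z) ≤ C₀) ∧
    ∀ z ∈ unitDisc, z ≠ α → ‖F z‖ * Real.sqrt (ω z) ≤
      C₀ * (min (τC α) (τC z) / ‖z - α‖) ^ (3 * n)

/-- Multiplication of an `L²_ω` element by the indicator of a measurable set `D`. -/
def indLp (ω : ℂ → ℝ) (D : Set ℂ) (hD : MeasurableSet D) (f : Lp ℂ 2 (muW ω)) :
    Lp ℂ 2 (muW ω) :=
  MemLp.toLp (D.indicator f) ((Lp.memLp f).indicator hD)

/-- The subspace of `L²_ω` of elements vanishing a.e. off `D` with a representative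
analytic on `D`;  its closure realizes `A²_ω(D)` inside `L²_ω`. -/
def localBergmanSub (ω : ℂ → ℝ) (D : Set ℂ) : Submodule ℂ (Lp ℂ 2 (muW ω)) where
  carrier := {f | ((f : ℂ → ℂ) =ᵐ[(muW ω).restrict Dᶜ] 0) ∧
    ∃ h : ℂ → ℂ, DifferentiableOn ℂ h D ∧ (f : ℂ → ℂ) =ᵐ[(muW ω).restrict D] h}
  zero_mem' := by
    refine ⟨ae_restrict_of_ae (Lp.coeFn_zero ℂ 2 (muW ω)), 0, differentiableOn_const 0,
      ae_restrict_of_ae (Lp.coeFn_zero ℂ 2 (muW ω))⟩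
  add_mem' := by
    rintro a b ⟨ha0, F, hF, ha⟩ ⟨hb0, G, hG, hb⟩
    refine ⟨?_, F + G, hF.add hG, ?_⟩
    · filter_upwards [ae_restrict_of_ae (Lp.coeFn_add a b), ha0, hb0] with w h1 h2 h3
      rw [h1]; simp only [Pi.add_apply, h2, h3, Pi.zero_apply, add_zero]
    · filter_upwards [ae_restrict_of_ae (Lp.coeFn_add a b), ha, hb] with w h1 h2 h3
      rw [h1]; simp only [Pi.add_apply, h2, h3]
  smul_mem' := by
    rintro c a ⟨ha0, F, hF, ha⟩
    refine ⟨?_, c • F, hF.const_smul c, ?_⟩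
    · filter_upwards [ae_restrict_of_ae (Lp.coeFn_smul c a), ha0] with w h1 h2
      rw [h1]; simp only [Pi.smul_apply, h2, Pi.zero_apply, smul_zero]
    · filter_upwards [ae_restrict_of_ae (Lp.coeFn_smul c a), ha] with w h1 h2
      rw [h1]; simp only [Pi.smul_apply, h2]

instance (ω : ℂ → ℝ) (D : Set ℂ) :
    CompleteSpace ((localBergmanSub ω D).topologicalClosure) :=
  IsComplete.completeSpace_coe (Submodule.isClosed_topologicalClosure _).isComplete

/-- The local projection `P_{α,δ}` (for `D = D(δτ(α))`), extended by zero off `D`,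
viewed as an operator of `L²_ω`. -/
def localProj (ω : ℂ → ℝ) (D : Set ℂ) : Lp ℂ 2 (muW ω) →L[ℂ] Lp ℂ 2 (muW ω) :=
  ((localBergmanSub ω D).topologicalClosure).subtypeL.comp
    (Submodule.orthogonalProjectionOnto ((localBergmanSub ω D).topologicalClosure))

/-- Greedy colouring of a graph on `ℕ`. -/
def greedyCol (A : ℕ → ℕ → Prop) (n : ℕ) : ℕ :=
  sInf {a : ℕ | ∀ m : ℕ, ∀ _ : m < n, A n m → greedyCol A m ≠ a}
termination_by n

theorem greedyCol_aux (A : ℕ → ℕ → Prop) (B : ℕ)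
    (hB : ∀ n, ∀ S : Finset ℕ, (∀ m ∈ S, A n m) → S.card ≤ B) (n : ℕ) :
    greedyCol A n ≤ B ∧ ∀ m, m < n → A n m → greedyCol A m ≠ greedyCol A n := by
  classical
  have hS := hB n ((Finset.range n).filter (fun m => A n m)) (by
    intro m hm; exact (Finset.mem_filter.1 hm).2)
  set S := (Finset.range n).filter (fun m => A n m) with hSdef
  have hcard : (S.image (greedyCol A)).card < (Finset.range (B + 1)).card := by
    rw [Finset.card_range]
    exact lt_of_le_of_lt Finset.card_image_le (by omega)
  obtain ⟨a, ha1, ha2⟩ := Finset.exists_mem_notMem_of_card_lt_card hcard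
  have hmem : a ∈ {a : ℕ | ∀ m : ℕ, ∀ _ : m < n, A n m → greedyCol A m ≠ a} := by
    intro m hm hA h
    apply ha2
    rw [Finset.mem_image]
    exact ⟨m, by simp [hSdef, hm, hA], h⟩
  have hin := Nat.sInf_mem ⟨a, hmem⟩
  have hle := Nat.sInf_le hmem
  rw [← greedyCol] at hin hle
  refine ⟨?_, hin⟩
  have := Finset.mem_range.1 ha1
  omega

theorem packing (K s : ℝ) (hs : 0 < s) : ∃ B : ℕ, ∀ (w : ℕ → ℂ) (S : Finset ℕ),
    (∀ j ∈ S, ‖w j‖ ≤ K) → (∀ i ∈ S, ∀ j ∈ S, i ≠ j → s ≤ ‖w i - w j‖) → S.card ≤ B := by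
  classical
  have hc : TotallyBounded (Metric.closedBall (0 : ℂ) K) :=
    (isCompact_closedBall (0 : ℂ) K).totallyBounded
  obtain ⟨t, htf, ht⟩ := Metric.totallyBounded_iff.1 hc (s / 2) (by positivity)
  refine ⟨htf.toFinset.card, fun w S h1 h2 => ?_⟩
  have h3 : ∀ j, ∃ y, j ∈ S → y ∈ t ∧ dist (w j) y < s / 2 := by
    intro j
    by_cases hj : j ∈ S
    · have := ht (show w j ∈ Metric.closedBall (0 : ℂ) K by simpa using h1 j hj)
      simp only [Set.mem_iUnion, Metric.mem_ball] at this
      obtain ⟨y, hy, hd⟩ := this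
      exact ⟨y, fun _ => ⟨hy, hd⟩⟩
    · exact ⟨0, fun h => absurd h hj⟩
  choose f hf using h3
  refine Finset.card_le_card_of_injOn f (fun j hj => by simpa using (hf j hj).1) ?_
  intro i hi j hj hij
  by_contra hne
  have a1 := (hf i hi).2
  have a2 := (hf j hj).2
  have a3 := h2 i hi j hj hne
  rw [← dist_eq_norm] at a3
  rw [← hij] at a2
  have := dist_triangle_right (w i) (w j) (f i)
  linarith

theorem stmt10 (ω φ : ℂ → ℝ) (τ : ℝ → ℝ) (c₁ c₂ : ℝ)
    (hW : IsClassW ω φ τ) (hL : IsClassL (radialize τ) c₁ c₂)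
    (δ : ℝ) (hδ : δ ∈ Set.Ioo 0 (mTau c₁ c₂)) (k : ℕ) (hk : 0 < k)
    (z : ℕ → ℂ) (hz : IsLattice (radialize τ) δ z) :
    ∃ M : ℕ, ∃ c : ℕ → Fin M, ∀ i j : ℕ, i ≠ j → c i = c j →
      (2 : ℝ) ^ k * δ ≤ dTau (radialize τ) (z i) (z j) := by
  classical
  obtain ⟨hδ0, -⟩ := hδ
  set T := radialize τ
  set K : ℝ := 2 ^ k * δ with hK
  have hK0 : 0 < K := by positivity
  have hc₂ := hL.c₂_pos
  have hTp : ∀ j, 0 < T (z j) := fun j => hL.pos _ (hz.mem j)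
  obtain ⟨B, hB⟩ := packing K (δ / (1 + c₂ * K)) (by positivity)
  let A : ℕ → ℕ → Prop := fun i j => ‖z i - z j‖ < K * min (T (z i)) (T (z j))
  have hdeg : ∀ n, ∀ S : Finset ℕ, (∀ m ∈ S, A n m) → S.card ≤ B := by
    intro n S hS
    have hn := hTp n
    have hnorm : ∀ x : ℂ, ‖x / (T (z n) : ℂ)‖ = ‖x‖ / T (z n) := by
      intro x
      rw [norm_div, Complex.norm_real, Real.norm_of_nonneg hn.le]
    refine hB (fun j => (z j - z n) / (T (z n) : ℂ)) S ?_ ?_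
    · intro j hj
      have h : ‖z n - z j‖ < K * min (T (z n)) (T (z j)) := hS j hj
      rw [hnorm, div_le_iff₀ hn, norm_sub_rev]
      exact h.le.trans (mul_le_mul_of_nonneg_left (min_le_left _ _) hK0.le)
    · intro i hi j hj hij
      have h : ‖z n - z j‖ < K * min (T (z n)) (T (z j)) := hS j hj
      have h' := h.le.trans (mul_le_mul_of_nonneg_left (min_le_right _ _) hK0.le)
      have hl := (abs_le.1 (hL.lip _ (hz.mem n) _ (hz.mem j))).2
      have hl2 : T (z n) ≤ (1 + c₂ * K) * T (z j) := by
        have := mul_le_mul_of_nonneg_left h' hc₂.le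
        have e : (1 + c₂ * K) * T (z j) = T (z j) + c₂ * (K * T (z j)) := by ring
        rw [e]
        change T (z n) - T (z j) ≤ _ at hl
        linarith
      have hsep := hz.sep i j hij
      rw [Metric.mem_ball, not_lt, dist_eq_norm] at hsep
      rw [← sub_div, hnorm, sub_sub_sub_cancel_right, div_le_div_iff₀ (by positivity) hn]
      have h4 := mul_le_mul_of_nonneg_left hl2 hδ0.le
      have h5 := mul_le_mul_of_nonneg_right hsep (show 0 ≤ 1 + c₂ * K by positivity)
      change δ * T (z j) * _ ≤ _ at h5
      linarith
  refine ⟨B + 1, fun n => ⟨greedyCol A n, Nat.lt_succ_of_le (greedyCol_aux A B hdeg n).1⟩, ?_⟩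
  intro i j hij hc
  have hc' : greedyCol A i = greedyCol A j := congrArg Fin.val hc
  have hnA : ¬ A i j := by
    intro hA
    rcases lt_or_gt_of_ne hij with h | h
    · refine (greedyCol_aux A B hdeg j).2 i h ?_ hc'
      change ‖z j - z i‖ < K * min (T (z j)) (T (z i))
      rw [norm_sub_rev, min_comm]
      exact hA
    · exact (greedyCol_aux A B hdeg i).2 j h hA hc'.symm
  have h6 : K * min (T (z i)) (T (z j)) ≤ ‖z i - z j‖ := not_lt.1 hnA
  exact (le_div_iff₀ (lt_min (hTp i) (hTp j))).2 h6

end
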